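/- Assume that a graph G contains exactly one nontrivial anticomponent Q (i.e., exactly one connected component of the complement of G has at least two vertices, and Q is the induced subgraph of G on its vertex set). Then G contains a simplicial vertex if and only if Q contains a simplicial vertex. -/

import Mathlib

open SimpleGraph

namespace Paper2P3

variable {V : Type*}

/-- `G` contains an induced subgraph isomorphic to `H`. -/
def ContainsInduced {V W : Type*} (G : SimpleGraph V) (H : SimpleGraph W) : Prop :=
  ∃ s : Set V, Nonempty (H ≃g G.induce s)

/-- `G` is `H`-free: no induced subgraph of `G` is isomorphic to `H`. -/
def HFree {V W : Type*} (G : SimpleGraph V) (H : SimpleGraph W) : Prop :=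
  ¬ ContainsInduced G H

/-- `S` is complete to `T` in `G`. -/
def Complete (G : SimpleGraph V) (S T : Set V) : Prop :=
  ∀ a ∈ S, ∀ b ∈ T, G.Adj a b

/-- `S` is anticomplete to `T` in `G`. -/
def Anticomplete (G : SimpleGraph V) (S T : Set V) : Prop :=
  ∀ a ∈ S, ∀ b ∈ T, ¬ G.Adj a b

/-- The closed neighborhood `N_G[v]`. -/
def closedNbhd (G : SimpleGraph V) (v : V) : Set V := insert v (G.neighborSet v)

/-- A simplicial vertex: its neighborhood is a clique. -/
def IsSimplicial (G : SimpleGraph V) (v : V) : Prop := G.IsClique (G.neighborSet v)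

/-- A universal vertex: adjacent to all other vertices. -/
def IsUniversalVertex (G : SimpleGraph V) (v : V) : Prop := ∀ w, w ≠ v → G.Adj v w

/-- `G` admits a clique-cutset: a clique `C ⊊ V(G)` such that `G - C` is disconnected. -/
def HasCliqueCutset (G : SimpleGraph V) : Prop :=
  ∃ C : Set V, G.IsClique C ∧ C ≠ Set.univ ∧ ¬ (G.induce Cᶜ).Connected

/-- The disjoint union of two copies of `P_3`, on vertices `0,1,2` and `3,4,5`. -/
def twoP3 : SimpleGraph (Fin 6) :=
  SimpleGraph.fromRel fun a b => (a, b) ∈ ([(0,1),(1,2),(3,4),(4,5)] : List (Fin 6 × Fin 6))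

/-- The edgeless graph on four vertices. -/
def fourK1 : SimpleGraph (Fin 4) := ⊥

/-- `Gs` is a thickening of `G`. -/
def IsThickening {α β : Type*} (Gs : SimpleGraph β) (G : SimpleGraph α) : Prop :=
  ∃ X : α → Set β,
    (∀ v, (X v).Nonempty) ∧
    (∀ u v : α, u ≠ v → Disjoint (X u) (X v)) ∧
    (⋃ v, X v) = Set.univ ∧
    (∀ v, Gs.IsClique (X v)) ∧
    (∀ u v : α, u ≠ v →
      (G.Adj u v → Complete Gs (X u) (X v)) ∧ (¬ G.Adj u v → Anticomplete Gs (X u) (X v)))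

/-- The closed neighborhoods of the vertices of `S` form a chain under inclusion;
equivalently (for finite graphs), `S` can be ordered as `a_1, …, a_r` with
`N_G[a_r] ⊆ ⋯ ⊆ N_G[a_1]`. -/
def ChainClosedNbhd (G : SimpleGraph V) (S : Set V) : Prop :=
  ∀ a ∈ S, ∀ b ∈ S, closedNbhd G a ⊆ closedNbhd G b ∨ closedNbhd G b ⊆ closedNbhd G a

/-- `A` can be partitioned into cliques, pairwise anticomplete to each other. -/
def CliquesPartition (G : SimpleGraph V) (A : Set V) : Prop :=
  ∃ (ℓ : ℕ) (P : Fin ℓ → Set V),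
    (∀ i, G.IsClique (P i)) ∧
    (∀ i j, i ≠ j → Disjoint (P i) (P j)) ∧
    (∀ i j, i ≠ j → Anticomplete G (P i) (P j)) ∧
    (⋃ i, P i) = A

/-- `A` can be partitioned into nonempty cliques, pairwise anticomplete to each other. -/
def NonemptyCliquesPartition (G : SimpleGraph V) (A : Set V) : Prop :=
  ∃ (ℓ : ℕ) (P : Fin ℓ → Set V),
    (∀ i, (P i).Nonempty) ∧
    (∀ i, G.IsClique (P i)) ∧
    (∀ i j, i ≠ j → Disjoint (P i) (P j)) ∧
    (∀ i j, i ≠ j → Anticomplete G (P i) (P j)) ∧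
    (⋃ i, P i) = A

/-- `A` can be partitioned into nonempty cliques, pairwise anticomplete to each other,
each of which can be ordered so that the closed neighborhoods form a decreasing chain. -/
def OrderedCliquesPartition (G : SimpleGraph V) (A : Set V) : Prop :=
  ∃ (ℓ : ℕ) (P : Fin ℓ → Set V),
    (∀ i, (P i).Nonempty) ∧
    (∀ i, G.IsClique (P i)) ∧
    (∀ i j, i ≠ j → Disjoint (P i) (P j)) ∧
    (∀ i j, i ≠ j → Anticomplete G (P i) (P j)) ∧
    (⋃ i, P i) = A ∧
    (∀ i, ChainClosedNbhd G (P i))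

/-- `(X_0,…,X_6; Y_0,…,Y_6; Z_0,…,Z_6; W)` is a special partition of the induced
subgraph of `G` on `S` (indices in `ℤ_7`). -/
def IsSpecialPartitionOn (G : SimpleGraph V) (S : Set V)
    (X Y Z : ZMod 7 → Set V) (W : Set V) : Prop :=
  -- the sets are pairwise disjoint and their union is `S`
  (∀ i j, i ≠ j → Disjoint (X i) (X j)) ∧
  (∀ i j, i ≠ j → Disjoint (Y i) (Y j)) ∧
  (∀ i j, i ≠ j → Disjoint (Z i) (Z j)) ∧
  (∀ i j, Disjoint (X i) (Y j)) ∧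
  (∀ i j, Disjoint (X i) (Z j)) ∧
  (∀ i j, Disjoint (Y i) (Z j)) ∧
  (∀ i, Disjoint (X i) W) ∧ (∀ i, Disjoint (Y i) W) ∧ (∀ i, Disjoint (Z i) W) ∧
  ((⋃ i, X i) ∪ (⋃ i, Y i) ∪ (⋃ i, Z i) ∪ W = S) ∧
  -- all the sets are cliques
  (∀ i, G.IsClique (X i)) ∧ (∀ i, G.IsClique (Y i)) ∧ (∀ i, G.IsClique (Z i)) ∧
  G.IsClique W ∧
  -- (a)
  (∀ i, (X i).Nonempty) ∧
  -- (b)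
  (∀ i, Complete G (X i) (X (i - 1)) ∧ Complete G (X i) (X (i + 1)) ∧
    Anticomplete G (X i) (X (i + 2)) ∧ Anticomplete G (X i) (X (i + 3)) ∧
    Anticomplete G (X i) (X (i + 4)) ∧ Anticomplete G (X i) (X (i + 5))) ∧
  -- (c)
  (∀ i, Complete G (X i) (Y i) ∧ Complete G (X i) (Y (i + 3)) ∧
    Complete G (X i) (Y (i + 6)) ∧ Complete G (X i) (Z i) ∧
    Complete G (X i) (Z (i + 3)) ∧ Complete G (X i) (Z (i + 4)) ∧
    Complete G (X i) (Z (i + 5)) ∧ Complete G (X i) (Z (i + 6)) ∧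
    Complete G (X i) W ∧
    Anticomplete G (X i) (Y (i + 1)) ∧ Anticomplete G (X i) (Y (i + 2)) ∧
    Anticomplete G (X i) (Y (i + 4)) ∧ Anticomplete G (X i) (Y (i + 5)) ∧
    Anticomplete G (X i) (Z (i + 1)) ∧ Anticomplete G (X i) (Z (i + 2))) ∧
  -- (d)
  (∀ i, (Y i).Nonempty →
    (Y (i + 1) = ∅ ∧ Y (i + 2) = ∅ ∧ Y (i + 5) = ∅ ∧ Y (i + 6) = ∅ ∧
      Z (i + 5) = ∅ ∧ Z (i + 6) = ∅) ∧ (Y (i + 3) = ∅ ∨ Y (i + 4) = ∅)) ∧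
  -- (e)
  (∀ i, (Z i).Nonempty → Z (i + 2) = ∅ ∧ Z (i + 5) = ∅) ∧
  -- (f)
  (∀ i, Complete G (Y i) (Y (i + 3)) ∧ Complete G (Y i) (Y (i + 4)) ∧
    Complete G (Y i) (Z i) ∧ Complete G (Y i) (Z (i + 1)) ∧
    Complete G (Y i) (Z (i + 3)) ∧ Complete G (Y i) (Z (i + 4)) ∧
    Complete G (Y i) W ∧ Anticomplete G (Y i) (Z (i + 2))) ∧
  -- (g)
  (∀ i, Complete G (Z i) (Z (i + 1)) ∧ Complete G (Z i) (Z (i + 3)) ∧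
    Complete G (Z i) (Z (i + 4)) ∧ Complete G (Z i) (Z (i + 6)) ∧ Complete G (Z i) W)

/-- `G` admits a special partition. -/
def AdmitsSpecialPartition (G : SimpleGraph V) : Prop :=
  ∃ (X Y Z : ZMod 7 → Set V) (W : Set V), IsSpecialPartitionOn G Set.univ X Y Z W

/-- `G` is a 7-saucer. -/
def IsSevenSaucer (G : SimpleGraph V) : Prop :=
  ∃ (X Y Z : ZMod 7 → Set V) (W A : Set V),
    IsSpecialPartitionOn G Aᶜ X Y Z W ∧
    (∀ i, Anticomplete G A (X i)) ∧
    (∀ i, Anticomplete G A (Y i) ∨ Z (i + 2) = ∅) ∧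
    (A = ∅ ∨ OrderedCliquesPartition G A)
/-- The graph `M_0`: vertices `0,…,6` are `x_0,…,x_6` (a 7-cycle), `7 = y_0`,
`8 = y_3`, `9 = z_0`, `10 = z_3`, `11 = z_4`. -/
def M0 : SimpleGraph (Fin 12) :=
  SimpleGraph.fromRel fun a b => (a, b) ∈
    ([(0,1),(1,2),(2,3),(3,4),(4,5),(5,6),(6,0),
      (7,0),(7,1),(7,4),
      (8,3),(8,4),(8,0),
      (9,0),(9,1),(9,2),(9,3),(9,4),
      (10,3),(10,4),(10,5),(10,6),(10,0),
      (11,4),(11,5),(11,6),(11,0),(11,1),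
      (7,8),(7,9),(7,10),(7,11),(8,9),(8,10),(8,11),(9,10),(9,11),(10,11)] :
      List (Fin 12 × Fin 12))

/-- The graph `M_1`: vertices `0,…,6` are `x_0,…,x_6` (a 7-cycle), `7 = y_0`, `8 = z_2`. -/
def M1 : SimpleGraph (Fin 9) :=
  SimpleGraph.fromRel fun a b => (a, b) ∈
    ([(0,1),(1,2),(2,3),(3,4),(4,5),(5,6),(6,0),
      (7,0),(7,1),(7,4),
      (8,2),(8,3),(8,4),(8,5),(8,6)] : List (Fin 9 × Fin 9))

/-- The graph `M_2`: `M_1` plus the vertex `9 = z_1`. -/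
def M2 : SimpleGraph (Fin 10) :=
  SimpleGraph.fromRel fun a b => (a, b) ∈
    ([(0,1),(1,2),(2,3),(3,4),(4,5),(5,6),(6,0),
      (7,0),(7,1),(7,4),
      (8,2),(8,3),(8,4),(8,5),(8,6),
      (9,1),(9,2),(9,3),(9,4),(9,5),(9,7),(9,8)] : List (Fin 10 × Fin 10))

/-- The graph `M_3`: `M_1` plus the vertex `9 = z_3`. -/
def M3 : SimpleGraph (Fin 10) :=
  SimpleGraph.fromRel fun a b => (a, b) ∈
    ([(0,1),(1,2),(2,3),(3,4),(4,5),(5,6),(6,0),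
      (7,0),(7,1),(7,4),
      (8,2),(8,3),(8,4),(8,5),(8,6),
      (9,3),(9,4),(9,5),(9,6),(9,0),(9,7),(9,8)] : List (Fin 10 × Fin 10))

/-- The set `{y_0, y_3, z_0, z_3, z_4}` of vertices of `M_0`. -/
def M0Extra : Set (Fin 12) := {7, 8, 9, 10, 11}

/-- `H` is a thickening of a graph in the family `ℳ`, which consists of
`M_1`, `M_2`, `M_3`, and all graphs `M_0 - S` for `S ⊆ {y_0,y_3,z_0,z_3,z_4}`. -/
def IsThickeningOfM {β : Type*} (H : SimpleGraph β) : Prop :=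
  IsThickening H M1 ∨ IsThickening H M2 ∨ IsThickening H M3 ∨
  ∃ S : Set (Fin 12), S ⊆ M0Extra ∧ IsThickening H (M0.induce Sᶜ)
/-- The graph `T_0`: vertices `0 = a_0`, `1 = a_1`, `2 = b_0`, `3 = b_1`, `4 = b_2`,
`5 = b_3`, `6 = c_1`, `7 = c_2`, `8 = c_3`. -/
def T0 : SimpleGraph (Fin 9) :=
  SimpleGraph.fromRel fun a b => (a, b) ∈
    ([(0,1),(0,2),(0,4),(0,5),(1,3),(1,4),(1,5),
      (2,6),(3,6),(4,7),(5,8),(6,7),(6,8),(7,8)] : List (Fin 9 × Fin 9))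

/-- The graph `T_1`: `T_0` plus the vertex `9 = f_3`, adjacent to
`a_0,a_1,b_0,b_1,b_2,c_1,c_2` and nonadjacent to `b_3,c_3`. -/
def T1 : SimpleGraph (Fin 10) :=
  SimpleGraph.fromRel fun a b => (a, b) ∈
    ([(0,1),(0,2),(0,4),(0,5),(1,3),(1,4),(1,5),
      (2,6),(3,6),(4,7),(5,8),(6,7),(6,8),(7,8),
      (9,0),(9,1),(9,2),(9,3),(9,4),(9,6),(9,7)] : List (Fin 10 × Fin 10))
/-- `(A_0,A_1;B_0,B_1,B_2,B_3;C_1,C_2,C_3;F_2,F_3;W;Y;Z)` is a tent partition of `G`. -/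
def IsTentPartition (G : SimpleGraph V)
    (A0 A1 B0 B1 B2 B3 C1 C2 C3 F2 F3 W Y Z : Set V) : Prop :=
  let P : Fin 14 → Set V := ![A0, A1, B0, B1, B2, B3, C1, C2, C3, F2, F3, W, Y, Z]
  -- the fourteen sets form a partition of the vertex set
  (∀ i j : Fin 14, i ≠ j → Disjoint (P i) (P j)) ∧
  (⋃ i, P i) = Set.univ ∧
  -- A_0,A_1,B_0,B_1,B_2,B_3,C_1,C_2,C_3 are nonempty cliques
  (A0.Nonempty ∧ A1.Nonempty ∧ B0.Nonempty ∧ B1.Nonempty ∧ B2.Nonempty ∧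
    B3.Nonempty ∧ C1.Nonempty ∧ C2.Nonempty ∧ C3.Nonempty) ∧
  (G.IsClique A0 ∧ G.IsClique A1 ∧ G.IsClique B0 ∧ G.IsClique B1 ∧ G.IsClique B2 ∧
    G.IsClique B3 ∧ G.IsClique C1 ∧ G.IsClique C2 ∧ G.IsClique C3) ∧
  -- F_2, F_3, Y are cliques, and at most one of them is nonempty
  (G.IsClique F2 ∧ G.IsClique F3 ∧ G.IsClique Y) ∧
  ((F2 = ∅ ∧ F3 = ∅) ∨ (F2 = ∅ ∧ Y = ∅) ∨ (F3 = ∅ ∧ Y = ∅)) ∧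
  -- W is a (possibly empty) clique
  G.IsClique W ∧
  Complete G A0 A1 ∧
  (Complete G A0 B0 ∧ Complete G A0 B2 ∧ Complete G A0 B3 ∧
    Anticomplete G A0 B1 ∧ Anticomplete G A0 C1 ∧ Anticomplete G A0 C2 ∧
    Anticomplete G A0 C3) ∧
  (Complete G A1 B1 ∧ Complete G A1 B2 ∧ Complete G A1 B3 ∧
    Anticomplete G A1 B0 ∧ Anticomplete G A1 C1 ∧ Anticomplete G A1 C2 ∧
    Anticomplete G A1 C3) ∧
  (Anticomplete G B0 B1 ∧ Anticomplete G B0 B2 ∧ Anticomplete G B0 B3 ∧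
    Anticomplete G B1 B2 ∧ Anticomplete G B1 B3 ∧ Anticomplete G B2 B3) ∧
  (Complete G C1 C2 ∧ Complete G C1 C3 ∧ Complete G C2 C3) ∧
  (Complete G C1 B0 ∧ Complete G C1 B1 ∧ Anticomplete G C1 B2 ∧ Anticomplete G C1 B3) ∧
  (Complete G C2 B2 ∧ Anticomplete G C2 B0 ∧ Anticomplete G C2 B1 ∧
    Anticomplete G C2 B3) ∧
  (Complete G C3 B3 ∧ Anticomplete G C3 B0 ∧ Anticomplete G C3 B1 ∧
    Anticomplete G C3 B2) ∧
  (Complete G F2 A0 ∧ Complete G F2 A1 ∧ Complete G F2 B0 ∧ Complete G F2 B1 ∧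
    Complete G F2 B3 ∧ Complete G F2 C1 ∧ Complete G F2 C3 ∧
    Anticomplete G F2 B2 ∧ Anticomplete G F2 C2) ∧
  (Complete G F3 A0 ∧ Complete G F3 A1 ∧ Complete G F3 B0 ∧ Complete G F3 B1 ∧
    Complete G F3 B2 ∧ Complete G F3 C1 ∧ Complete G F3 C2 ∧
    Anticomplete G F3 B3 ∧ Anticomplete G F3 C3) ∧
  (Complete G W A0 ∧ Complete G W A1 ∧ Complete G W B0 ∧ Complete G W B1 ∧
    Complete G W B2 ∧ Complete G W B3 ∧ Complete G W C1 ∧ Complete G W C2 ∧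
    Complete G W C3 ∧ Complete G W F2 ∧ Complete G W F3) ∧
  (Complete G Y C2 ∧ Complete G Y C3 ∧
    Anticomplete G Y A0 ∧ Anticomplete G Y A1 ∧ Anticomplete G Y B0 ∧
    Anticomplete G Y B1 ∧ Anticomplete G Y B2 ∧ Anticomplete G Y B3 ∧
    Anticomplete G Y C1) ∧
  (Anticomplete G Z A0 ∧ Anticomplete G Z A1 ∧ Anticomplete G Z B0 ∧
    Anticomplete G Z B1 ∧ Anticomplete G Z B2 ∧ Anticomplete G Z B3 ∧
    Anticomplete G Z C1 ∧ Anticomplete G Z C2 ∧ Anticomplete G Z C3 ∧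
    Anticomplete G Z Y) ∧
  -- Y can be ordered so that the closed neighborhoods form a chain
  ChainClosedNbhd G Y ∧
  -- Z is empty or can be partitioned into nonempty cliques, pairwise anticomplete,
  -- each ordered so that the closed neighborhoods form a chain
  (Z = ∅ ∨ OrderedCliquesPartition G Z)

/-- `G` is a tent. -/
def IsTent (G : SimpleGraph V) : Prop :=
  ∃ A0 A1 B0 B1 B2 B3 C1 C2 C3 F2 F3 W Y Z : Set V,
    IsTentPartition G A0 A1 B0 B1 B2 B3 C1 C2 C3 F2 F3 W Y Z

/-- If every anticomponent other than `c` is trivial, a vertex outside `c` is universal. -/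
theorem isUniversalVertex_of_notMem_supp {V : Type*} {G : SimpleGraph V}
    {c : Gᶜ.ConnectedComponent}
    (huniq : ∀ d : Gᶜ.ConnectedComponent, d ≠ c → d.supp.Subsingleton)
    {v : V} (hv : v ∉ c.supp) : IsUniversalVertex G v := by
  intro w hwv
  by_contra hn
  have hadj : Gᶜ.Adj w v := by
    rw [SimpleGraph.compl_adj]
    exact ⟨hwv, fun h => hn h.symm⟩
  have hw : w ∈ (Gᶜ.connectedComponentMk v).supp :=
    SimpleGraph.ConnectedComponent.sound hadj.reachable
  exact hwv (huniq _ hv hw rfl)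

/-- A simplicial vertex of `G` lying in `s` is simplicial in `G.induce s`. -/
theorem IsSimplicial.induce {V : Type*} {G : SimpleGraph V} {s : Set V} {v : V}
    (h : IsSimplicial G v) (hv : v ∈ s) : IsSimplicial (G.induce s) ⟨v, hv⟩ :=
  fun _ hx _ hy hxy => h hx hy fun e => hxy (Subtype.ext e)

/-- If a graph `G` has exactly one nontrivial anticomponent `Q` (the induced subgraph
on the support of the unique nontrivial connected component of the complement of
`G`), then `G` contains a simplicial vertex if and only if `Q` does. -/
theorem statement19 {V : Type*} [Fintype V] (G : SimpleGraph V)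
    (c : Gᶜ.ConnectedComponent) (hc : c.supp.Nontrivial)
    (huniq : ∀ d : Gᶜ.ConnectedComponent, d ≠ c → d.supp.Subsingleton) :
    (∃ v : V, IsSimplicial G v) ↔ (∃ v, IsSimplicial (G.induce c.supp) v) := by
  constructor
  · rintro ⟨v, hv⟩
    by_cases hvc : v ∈ c.supp
    · exact ⟨⟨v, hvc⟩, hv.induce hvc⟩
    · obtain ⟨a, ha⟩ := hc.nonempty
      have huniv := isUniversalVertex_of_notMem_supp huniq hvc
      have hne : ∀ x : c.supp, (x : V) ≠ v := fun x e => hvc (e ▸ x.2)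
      exact ⟨⟨a, ha⟩, fun x _ y _ hxy =>
        hv (huniv x (hne x)) (huniv y (hne y)) fun e => hxy (Subtype.ext e)⟩
  · rintro ⟨v, hv⟩
    refine ⟨v, fun x hx y hy hxy => ?_⟩
    by_cases hxc : x ∈ c.supp
    · by_cases hyc : y ∈ c.supp
      · exact hv (show (G.induce c.supp).Adj v ⟨x, hxc⟩ from hx)
          (show (G.induce c.supp).Adj v ⟨y, hyc⟩ from hy)
          fun e => hxy (congrArg Subtype.val e)
      · exact (isUniversalVertex_of_notMem_supp huniq hyc x hxy).symm
    · exact isUniversalVertex_of_notMem_supp huniq hxc y hxy.symm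

end Paper2P3
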